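/- arXiv:1810.02077 — 2 statements merged into one kernel-verified Lean document; each statement's English description precedes it below -/
import Mathlib

section
/- Assume 1 ≤ μ1. Let F_1, …, F_n be elements of the kernel of ψ and let (a_1,b_1), …, (a_n,b_n) be pairwise distinct pairs of nonnegative integers such that Ω(F_k) = X^{a_k}·Y^{b_k}·(α·Y − β·X) for each k. Then there exists a finite set G of polynomials generating the kernel of ψ such that {F_1,…,F_n} ⊆ G and no proper subset of G generates the kernel of ψ. -/
open MvPolynomial

noncomputable section

/-- The polynomial ring `K[T0,T1]`. -/
abbrev PT (K : Type) [Field K] := MvPolynomial (Fin 2) K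

/-- The polynomial ring `K[T0,T1,X,Y]`; `Sum.inr 0 = X`, `Sum.inr 1 = Y`. -/
abbrev PTXY (K : Type) [Field K] := MvPolynomial (Fin 2 ⊕ Fin 2) K

/-- The polynomial ring `K[T0,T1,s]`; `Sum.inr () = s`. -/
abbrev PTs (K : Type) [Field K] := MvPolynomial (Fin 2 ⊕ Unit) K

/-- The polynomial ring `K[T0,T1,Z_0,Z_1,Z_2]`. -/
abbrev PTZ (K : Type) [Field K] := MvPolynomial (Fin 2 ⊕ Fin 3) K

/-- The map `ψ : K[T0,T1,Z_0,Z_1,Z_2] → K[T0,T1,s]` with `Z_i ↦ f_i·s`. -/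
def psiMap (K : Type) [Field K] (f : Fin 3 → PT K) : PTZ K →ₐ[K] PTs K :=
  aeval (Sum.elim (fun i => X (Sum.inl i))
    (fun i => rename Sum.inl (f i) * X (Sum.inr ())))

/-- The map `Ω : K[T0,T1,Z_0,Z_1,Z_2] → K[T0,T1,X,Y]` with `Z_i ↦ A_i·X + B_i·Y`. -/
def OmegaMap (K : Type) [Field K] (A B : Fin 3 → PT K) : PTZ K →ₐ[K] PTXY K :=
  aeval (Sum.elim (fun i => X (Sum.inl i))
    (fun i => rename Sum.inl (A i) * X (Sum.inr 0) + rename Sum.inl (B i) * X (Sum.inr 1)))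

/-- If the ideals `I k` separate the elements `F k` of a finitely generated ideal `P`, in the sense
that `I k` contains every `F j` with `j ≠ k` but not `F k`, and every element of `P` lies in
`I k` up to a multiple of `F k`, then the `F k` extend to an irredundant generating set of `P`. -/
theorem exists_irredundant_generators_of_separating_ideals {S ι : Type*} [CommRing S] [Fintype ι]
    {P : Ideal S} (hP : P.FG) (F : ι → S) (I : ι → Ideal S) (hF : ∀ k, F k ∈ P)
    (hne : ∀ j k, j ≠ k → F j ∈ I k) (hself : ∀ k, F k ∉ I k)
    (hsub : ∀ k, ∀ h ∈ P, ∃ c, h - c * F k ∈ I k) :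
    ∃ G : Finset S, Ideal.span (G : Set S) = P ∧ (∀ k, F k ∈ G) ∧
      ∀ G' ⊂ G, Ideal.span (G' : Set S) ≠ P := by
  classical
  obtain ⟨H₀, hH₀⟩ := hP
  choose! c hc using hsub
  let r : S → S := fun h => h - ∑ k, c k h * F k
  have hrI : ∀ k, ∀ h ∈ P, r h ∈ I k := by
    intro k h hh
    have : r h = (h - c k h * F k) - ∑ j ∈ Finset.univ.erase k, c j h * F j := by
      simp only [r]
      rw [← Finset.add_sum_erase _ _ (Finset.mem_univ k)]
      ring
    rw [this]
    exact sub_mem (hc k h hh) (sum_mem fun j hj =>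
      Ideal.mul_mem_left _ _ (hne j k (Finset.ne_of_mem_erase hj)))
  have hrP : ∀ h ∈ P, r h ∈ P := fun h hh =>
    sub_mem hh (sum_mem fun k _ => Ideal.mul_mem_left _ _ (hF k))
  have hH₀P : ∀ h ∈ H₀, h ∈ P := fun h hh => hH₀ ▸ Ideal.subset_span hh
  let F' : Finset S := Finset.univ.image F
  have hF' : ∀ k, F k ∈ F' := fun k => Finset.mem_image_of_mem F (Finset.mem_univ k)
  let T : Finset (Finset S) := (H₀.image r).powerset.filter
    fun H => Ideal.span ((F' ∪ H : Finset S) : Set S) = P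
  have hT : T.Nonempty := by
    refine ⟨H₀.image r, Finset.mem_filter.2 ⟨Finset.mem_powerset_self _, ?_⟩⟩
    apply le_antisymm
    · rw [Ideal.span_le]
      intro g hg
      rcases Finset.mem_union.1 (Finset.mem_coe.1 hg) with hg | hg
      · obtain ⟨k, -, rfl⟩ := Finset.mem_image.1 hg
        exact hF k
      · obtain ⟨h, hh, rfl⟩ := Finset.mem_image.1 hg
        exact hrP h (hH₀P h hh)
    · conv_lhs => rw [← hH₀]
      refine Ideal.span_le.2 fun h hh => ?_
      have h_eq : h = r h + ∑ k, c k h * F k := by simp [r]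
      rw [h_eq]
      exact add_mem
        (Ideal.subset_span (Finset.mem_union_right _ (Finset.mem_image_of_mem r hh)))
        (sum_mem fun k _ => Ideal.mul_mem_left _ _
          (Ideal.subset_span (Finset.mem_union_left _ (hF' k))))
  obtain ⟨H, hH⟩ := T.exists_minimal hT
  obtain ⟨hHr, hHP⟩ := Finset.mem_filter.1 hH.1
  rw [Finset.mem_powerset] at hHr
  refine ⟨F' ∪ H, hHP, fun k => Finset.mem_union_left _ (hF' k), fun G' hG' hspan => ?_⟩
  by_cases hFG : F' ⊆ G'
  · have hG'_eq : F' ∪ (G' ∩ H) = G' := by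
      rw [Finset.union_inter_distrib_left, Finset.union_eq_right.2 hFG]
      exact Finset.inter_eq_left.2 hG'.1
    have hmem : G' ∩ H ∈ T := Finset.mem_filter.2
      ⟨Finset.mem_powerset.2 (Finset.inter_subset_right.trans hHr), by rw [hG'_eq, hspan]⟩
    have hHG' : H ⊆ G' := (hH.2 hmem Finset.inter_subset_right).trans Finset.inter_subset_left
    exact hG'.2 (Finset.union_subset hFG hHG')
  · obtain ⟨g, hg, hgG'⟩ := Finset.not_subset.1 hFG
    obtain ⟨k, -, rfl⟩ := Finset.mem_image.1 hg
    refine hself k ((Ideal.span_le.2 ?_ : Ideal.span (G' : Set S) ≤ I k) (hspan ▸ hF k))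
    intro g hgG
    rcases Finset.mem_union.1 (hG'.1 hgG) with hgF | hgH
    · obtain ⟨j, -, rfl⟩ := Finset.mem_image.1 hgF
      exact hne j k fun hjk => hgG' (hjk ▸ hgG)
    · obtain ⟨h, hh, rfl⟩ := Finset.mem_image.1 (hHr hgH)
      exact hrI k h (hH₀P h hh)

/-- The linear form `a·Y - b·X` in `R[X,Y]`. -/
def crossForm {R : Type*} [CommRing R] (a b : R) : MvPolynomial (Fin 2) R :=
  C a * X 1 - C b * X 0

theorem crossForm_prime {R : Type*} [CommRing R] [IsDomain R] [UniqueFactorizationMonoid R]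
    {a b : R} (ha : a ≠ 0) (hab : ∀ c, c ∣ a → c ∣ b → IsUnit c) : Prime (crossForm a b) := by
  have h1 : (crossForm a b).coeff (Finsupp.single 1 1) = a := by
    simp [crossForm, coeff_C_mul, coeff_X, Finsupp.single_left_inj]
  have h0 : (crossForm a b).coeff (Finsupp.single 0 1) = -b := by
    simp [crossForm, coeff_C_mul, coeff_X, Finsupp.single_left_inj]
  refine (irreducible_of_totalDegree_eq_one (le_antisymm ?_ ?_) fun c hc => ?_).prime
  · refine (totalDegree_sub _ _).trans (max_le ?_ ?_) <;>
      exact (totalDegree_mul _ _).trans (by simp)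
  · have := le_totalDegree (p := crossForm a b) (s := Finsupp.single 1 1)
      (mem_support_iff.2 (by rwa [h1]))
    simpa using this
  · exact hab c (h1 ▸ hc _) (by simpa [h0] using hc (Finsupp.single 0 1))

/-- The substitution `X ↦ a·s`, `Y ↦ b·s` from `R[X,Y]` to `R[s]`. -/
def lineEval {R : Type*} [CommRing R] (a b : R) :
    MvPolynomial (Fin 2) R →ₐ[R] Polynomial R :=
  aeval ![Polynomial.C a * Polynomial.X, Polynomial.C b * Polynomial.X]

theorem exists_crossForm_dvd_pow_mul_sub {R : Type*} [CommRing R] (a b : R)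
    (p : MvPolynomial (Fin 2) R) :
    ∃ (N : ℕ) (u : Polynomial R),
      crossForm a b ∣ C a ^ N * p - Polynomial.aeval (X 0 : MvPolynomial (Fin 2) R) u := by
  induction p using MvPolynomial.induction_on with
  | C r => exact ⟨0, Polynomial.C r, by simp⟩
  | add p q hp hq =>
    obtain ⟨N, u, v, hv⟩ := hp
    obtain ⟨M, w, z, hz⟩ := hq
    refine ⟨N + M, Polynomial.C a ^ M * u + Polynomial.C a ^ N * w,
      C a ^ M * v + C a ^ N * z, ?_⟩
    simp only [map_add, map_mul, map_pow, Polynomial.aeval_C, algebraMap_eq]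
    linear_combination C a ^ M * hv + C a ^ N * hz
  | mul_X p i hp =>
    obtain ⟨N, u, v, hv⟩ := hp
    fin_cases i
    · refine ⟨N, u * Polynomial.X, v * X 0, ?_⟩
      simp only [map_mul, Polynomial.aeval_X, Fin.zero_eta]
      linear_combination X 0 * hv
    · refine ⟨N + 1, Polynomial.C b * u * Polynomial.X,
        C a * X 1 * v + Polynomial.aeval (X 0 : MvPolynomial (Fin 2) R) u, ?_⟩
      simp only [map_mul, Polynomial.aeval_X, Polynomial.aeval_C, algebraMap_eq, Fin.mk_one]
      rw [pow_succ]
      unfold crossForm at *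
      linear_combination C a * X 1 * hv

theorem crossForm_dvd_of_lineEval_eq_zero {R : Type*} [CommRing R] [IsDomain R]
    [UniqueFactorizationMonoid R] {a b : R} (ha : a ≠ 0)
    (hab : ∀ c, c ∣ a → c ∣ b → IsUnit c) {p : MvPolynomial (Fin 2) R}
    (hp : lineEval a b p = 0) : crossForm a b ∣ p := by
  obtain ⟨N, u, hu⟩ := exists_crossForm_dvd_pow_mul_sub a b p
  have hL : lineEval a b (crossForm a b) = 0 := by
    simp only [lineEval, crossForm, map_sub, map_mul, aeval_C, aeval_X, Matrix.cons_val_zero,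
      Matrix.cons_val_one, Polynomial.algebraMap_eq]
    ring
  have hcomp : u.comp (Polynomial.C a * Polynomial.X) = 0 := by
    obtain ⟨v, hv⟩ := hu
    have h := congrArg (lineEval a b) hv
    rw [map_mul, hL, zero_mul, map_sub, map_mul, hp, mul_zero, zero_sub, neg_eq_zero,
      ← Polynomial.aeval_algHom_apply] at h
    simpa [lineEval, Polynomial.comp, Polynomial.aeval_def] using h
  have hu0 : u = 0 := by
    ext n
    have h := congrArg (Polynomial.coeff · n) hcomp
    simpa [Polynomial.comp_C_mul_X_coeff, ha] using h
  rw [hu0, map_zero, sub_zero] at hu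
  refine ((crossForm_prime ha hab).dvd_or_dvd hu).resolve_left fun h => ha ?_
  obtain ⟨v, hv⟩ := (crossForm_prime ha hab).dvd_of_dvd_pow h
  simpa [crossForm] using congrArg constantCoeff hv

/-- The identification of `K[T0,T1,X,Y]` with `K[T0,T1][X,Y]`. -/
def splitTXY (K : Type) [Field K] : PTXY K →ₐ[K] MvPolynomial (Fin 2) (PT K) :=
  aeval (Sum.elim (fun i => C (X i)) X)

theorem splitTXY_rename_inl {K : Type} [Field K] (p : PT K) :
    splitTXY K (rename Sum.inl p) = C p := by
  have : (splitTXY K).comp (rename Sum.inl) =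
      IsScalarTower.toAlgHom K (PT K) (MvPolynomial (Fin 2) (PT K)) := by
    ext i
    simp [splitTXY, algebraMap_eq]
  exact DFunLike.congr_fun this p

/-- The identification of `K[T0,T1,s]` with `K[T0,T1][s]`. -/
def splitTs (K : Type) [Field K] : PTs K →ₐ[K] Polynomial (PT K) :=
  aeval (Sum.elim (fun i => Polynomial.C (X i)) fun _ => Polynomial.X)

theorem splitTs_rename_inl {K : Type} [Field K] (p : PT K) :
    splitTs K (rename Sum.inl p) = Polynomial.C p := by
  have : (splitTs K).comp (rename Sum.inl) =
      IsScalarTower.toAlgHom K (PT K) (Polynomial (PT K)) := by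
    ext i
    simp [splitTs, Polynomial.algebraMap_eq]
  exact DFunLike.congr_fun this p

theorem lineEval_splitTXY_OmegaMap {K : Type} [Field K] {α β : PT K} {A B f : Fin 3 → PT K}
    (hf : ∀ i, f i = α * A i + β * B i) (g : PTZ K) :
    lineEval α β (splitTXY K (OmegaMap K A B g)) = splitTs K (psiMap K f g) := by
  have : (((lineEval α β).restrictScalars K).comp (splitTXY K)).comp (OmegaMap K A B) =
      (splitTs K).comp (psiMap K f) := by
    ext1 i
    rcases i with i | i
    · simp [OmegaMap, psiMap, splitTXY, splitTs, lineEval, Polynomial.algebraMap_eq]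
    · simp only [OmegaMap, psiMap, AlgHom.comp_apply, aeval_X, Sum.elim_inr, map_add, map_mul,
        splitTXY_rename_inl, splitTs_rename_inl, AlgHom.restrictScalars_apply, hf]
      simp only [splitTXY, splitTs, lineEval, aeval_X, Sum.elim_inr, aeval_C,
        Polynomial.algebraMap_eq, Matrix.cons_val_zero, Matrix.cons_val_one]
      ring
  exact DFunLike.congr_fun this g

theorem map_constantCoeff_splitTXY_OmegaMap {K : Type} [Field K] {A B : Fin 3 → PT K}
    (hA : ∀ i, constantCoeff (A i) = 0) (hB : ∀ i, constantCoeff (B i) = 0) (g : PTZ K) :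
    map constantCoeff (splitTXY K (OmegaMap K A B g)) = C (constantCoeff g) := by
  have : (map constantCoeff).comp
      ((splitTXY K).comp (OmegaMap K A B) : PTZ K →+* MvPolynomial (Fin 2) (PT K)) =
      (C : K →+* MvPolynomial (Fin 2) K).comp constantCoeff := by
    apply MvPolynomial.ringHom_ext
    · intro r
      simp [OmegaMap, splitTXY, MvPolynomial.algebraMap_apply, MvPolynomial.algebraMap_eq]
    · rintro (i | i)
      · simp [OmegaMap, splitTXY]
      · simp [OmegaMap, splitTXY_rename_inl, hA, hB]
  exact DFunLike.congr_fun this g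

/-- The ideal of those `g` such that `Ω(g)` is a multiple of `α·Y - β·X` whose cofactor has
vanishing `m`-th coefficient at `T0 = T1 = 0`. -/
def cofactorIdeal {K : Type} [Field K] (α β : PT K) {A B : Fin 3 → PT K}
    (hA : ∀ i, constantCoeff (A i) = 0) (hB : ∀ i, constantCoeff (B i) = 0) (m : Fin 2 →₀ ℕ) :
    Ideal (PTZ K) where
  carrier := {g | ∃ q, splitTXY K (OmegaMap K A B g) = crossForm α β * q ∧
    coeff m (map constantCoeff q) = 0}
  zero_mem' := ⟨0, by simp, by simp⟩
  add_mem' := by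
    rintro g h ⟨q, hq, hq0⟩ ⟨r, hr, hr0⟩
    exact ⟨q + r, by rw [map_add, map_add, hq, hr, mul_add],
      by rw [map_add, coeff_add, hq0, hr0, add_zero]⟩
  smul_mem' := by
    rintro c g ⟨q, hq, hq0⟩
    refine ⟨splitTXY K (OmegaMap K A B c) * q, ?_, ?_⟩
    · rw [smul_eq_mul, map_mul, map_mul, hq]
      ring
    · rw [map_mul, map_constantCoeff_splitTXY_OmegaMap hA hB, coeff_C_mul, hq0, mul_zero]

theorem stmt16 (K : Type) [Field K] (d μ1 μ2 : ℕ) (hμ1 : 1 ≤ μ1) (hμ12 : μ1 ≤ μ2)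
    (hd : 2 * (μ1 + μ2) ≤ d)
    (α β : PT K) (hα0 : α ≠ 0) (hβ0 : β ≠ 0)
    (hα : α.IsHomogeneous (d - μ1)) (hβ : β.IsHomogeneous (d - μ2))
    (hcop : ∀ c : PT K, c ∣ α → c ∣ β → IsUnit c)
    (A B : Fin 3 → PT K)
    (hAhom : ∀ i, (A i).IsHomogeneous μ1) (hBhom : ∀ i, (B i).IsHomogeneous μ2)
    (f : Fin 3 → PT K) (hf : ∀ i, f i = α * A i + β * B i)
    (n : ℕ) (F : Fin n → PTZ K) (ab : Fin n → ℕ × ℕ)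
    (hab : Function.Injective ab)
    (hFker : ∀ k, psiMap K f (F k) = 0)
    (hFΩ : ∀ k, OmegaMap K A B (F k) =
      X (Sum.inr 0) ^ (ab k).1 * X (Sum.inr 1) ^ (ab k).2 *
        ((rename Sum.inl α : PTXY K) * X (Sum.inr 1)
          - (rename Sum.inl β : PTXY K) * X (Sum.inr 0))) :
    ∃ G : Finset (PTZ K),
      Ideal.span (G : Set (PTZ K)) = RingHom.ker (psiMap K f) ∧
      (∀ k, F k ∈ G) ∧
      ∀ G' ⊂ G, Ideal.span (G' : Set (PTZ K)) ≠ RingHom.ker (psiMap K f) := by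
  have hA : ∀ i, constantCoeff (A i) = 0 := fun i =>
    (hAhom i).coeff_eq_zero (by simpa using (by omega : 0 ≠ μ1))
  have hB : ∀ i, constantCoeff (B i) = 0 := fun i =>
    (hBhom i).coeff_eq_zero (by simpa using (by omega : 0 ≠ μ2))
  let m : Fin n → Fin 2 →₀ ℕ := fun k => Finsupp.single 0 (ab k).1 + Finsupp.single 1 (ab k).2
  have hm : ∀ j k, m j = m k → j = k := fun j k h => hab <| Prod.ext
    (by simpa [m] using DFunLike.congr_fun h 0) (by simpa [m] using DFunLike.congr_fun h 1)
  have hF : ∀ k, splitTXY K (OmegaMap K A B (F k)) = crossForm α β * monomial (m k) 1 := by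
    intro k
    have hmon : (monomial (m k) 1 : MvPolynomial (Fin 2) (PT K)) =
        X 0 ^ (ab k).1 * X 1 ^ (ab k).2 := by
      simp [m, X_pow_eq_monomial, monomial_mul]
    rw [hFΩ, hmon]
    simp only [map_mul, map_sub, map_pow, splitTXY_rename_inl]
    simp only [splitTXY, aeval_X, Sum.elim_inr, crossForm]
    ring
  refine exists_irredundant_generators_of_separating_ideals (IsNoetherian.noetherian _) F
    (fun k => cofactorIdeal α β hA hB (m k)) hFker ?_ ?_ ?_
  · intro j k hjk
    exact ⟨_, hF j, by simp [coeff_monomial, mt (hm j k) hjk]⟩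
  · rintro k ⟨q, hq, hq0⟩
    rw [hF] at hq
    rw [← mul_left_cancel₀ (crossForm_prime hα0 hcop).ne_zero hq] at hq0
    simp at hq0
  · intro k h hh
    have hline : lineEval α β (splitTXY K (OmegaMap K A B h)) = 0 := by
      rw [lineEval_splitTXY_OmegaMap hf, RingHom.mem_ker.1 hh, map_zero]
    obtain ⟨q, hq⟩ := crossForm_dvd_of_lineEval_eq_zero hα0 hcop hline
    let r := coeff (m k) (map constantCoeff q)
    refine ⟨C r, q - C (C r) * monomial (m k) 1, ?_, ?_⟩
    · have hC : splitTXY K (OmegaMap K A B (C r)) = C (C r) := by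
        simp [OmegaMap, splitTXY, MvPolynomial.algebraMap_apply, MvPolynomial.algebraMap_eq]
      rw [map_sub, map_sub, map_mul, map_mul, hF, hq, hC]
      ring
    · simp [r, coeff_C_mul]
end
end

section
/- Let i, j, k, s, t be nonnegative integers with t ≤ s. Suppose A' ∈ K[T0,T1,X_0,…,X_{μ1},Y_0,…,Y_{μ2}] is trihomogeneous of degree (i,j,k+1) with ε(A') = α·T0^t·T1^{s−t}, and B' is trihomogeneous of degree (i,j+1,k) with ε(B') = β·T0^t·T1^{s−t}. Then Φ'(A' − B') = (α·Y − β·X)·X^j·Y^k·T0^t·T1^{s−t}. -/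
open MvPolynomial

noncomputable section

/-- The polynomial ring `K[T0,T1,X_0,…,X_{μ1},Y_0,…,Y_{μ2}]`. -/
abbrev PBig (K : Type) [Field K] (μ1 μ2 : ℕ) :=
  MvPolynomial (Fin 2 ⊕ (Fin (μ1+1) ⊕ Fin (μ2+1))) K

/-- The map `Φ'`. -/
def Phi'Map (K : Type) [Field K] (μ1 μ2 : ℕ) :
    PBig K μ1 μ2 →ₐ[K] PTXY K :=
  aeval (Sum.elim (fun i => X (Sum.inl i))
    (Sum.elim
      (fun i => X (Sum.inl 0) ^ (μ1 - (i : ℕ)) * X (Sum.inl 1) ^ (i : ℕ) * X (Sum.inr 0))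
      (fun i => X (Sum.inl 0) ^ (μ2 - (i : ℕ)) * X (Sum.inl 1) ^ (i : ℕ) * X (Sum.inr 1))))

/-- The map `ε`, fixing `T0,T1`, with `X_i ↦ T0^{μ1-i}·T1^i` and `Y_i ↦ T0^{μ2-i}·T1^i`. -/
def epsMap (K : Type) [Field K] (μ1 μ2 : ℕ) :
    PBig K μ1 μ2 →ₐ[K] PT K :=
  aeval (Sum.elim X
    (Sum.elim
      (fun i => X 0 ^ (μ1 - (i : ℕ)) * X 1 ^ (i : ℕ))
      (fun i => X 0 ^ (μ2 - (i : ℕ)) * X 1 ^ (i : ℕ))))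

/-- Weight function giving degree in the variables `T0,T1`. -/
def wT (μ1 μ2 : ℕ) : Fin 2 ⊕ (Fin (μ1+1) ⊕ Fin (μ2+1)) → ℕ :=
  Sum.elim (fun _ => 1) (fun _ => 0)

/-- Weight function giving degree in the variables `X_0,…,X_{μ1}`. -/
def wX (μ1 μ2 : ℕ) : Fin 2 ⊕ (Fin (μ1+1) ⊕ Fin (μ2+1)) → ℕ :=
  Sum.elim (fun _ => 0) (Sum.elim (fun _ => 1) (fun _ => 0))

/-- Weight function giving degree in the variables `Y_0,…,Y_{μ2}`. -/
def wY (μ1 μ2 : ℕ) : Fin 2 ⊕ (Fin (μ1+1) ⊕ Fin (μ2+1)) → ℕ :=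
  Sum.elim (fun _ => 0) (Sum.elim (fun _ => 0) (fun _ => 1))

/-- `F` is trihomogeneous of degree `(i,j,k)`. -/
def TriHom (K : Type) [Field K] (μ1 μ2 : ℕ) (F : PBig K μ1 μ2) (i j k : ℕ) : Prop :=
  F.IsWeightedHomogeneous (wT μ1 μ2) i ∧
  F.IsWeightedHomogeneous (wX μ1 μ2) j ∧
  F.IsWeightedHomogeneous (wY μ1 μ2) k

/-- Twisting the values of the variables by powers of `u` prescribed by a weight multiplies the
value of a weighted homogeneous polynomial by the corresponding power of `u`. -/
theorem aeval_mul_pow_of_isWeightedHomogeneous {σ R S : Type*} [CommSemiring R] [CommSemiring S]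
    [Algebra R S] {w : σ → ℕ} {n : ℕ} {F : MvPolynomial σ R} (hF : F.IsWeightedHomogeneous w n)
    (f : σ → S) (u : S) :
    aeval (fun a => f a * u ^ w a) F = aeval f F * u ^ n := by
  rw [aeval_def, aeval_def, eval₂_eq, eval₂_eq, Finset.sum_mul]
  refine Finset.sum_congr rfl fun m hm => ?_
  have hw := hF (mem_support_iff.mp hm)
  rw [Finsupp.weight_apply, Finsupp.sum] at hw
  simp only [mul_pow, Finset.prod_mul_distrib, ← pow_mul, Finset.prod_pow_eq_pow_sum, ← hw,
    smul_eq_mul, mul_comm (w _), mul_assoc]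

/-- On trihomogeneous polynomials, `Φ'` is determined by `ε` and the degrees in `X` and `Y`. -/
theorem Phi'Map_eq_of_triHom {K : Type} [Field K] {μ1 μ2 : ℕ} {F : PBig K μ1 μ2} {i j k : ℕ}
    (hF : TriHom K μ1 μ2 F i j k) :
    Phi'Map K μ1 μ2 F =
      rename Sum.inl (epsMap K μ1 μ2 F) * X (Sum.inr 0) ^ j * X (Sum.inr 1) ^ k := by
  obtain ⟨-, hX, hY⟩ := hF
  rw [epsMap, ← AlgHom.comp_apply, comp_aeval, ← aeval_mul_pow_of_isWeightedHomogeneous hX,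
    ← aeval_mul_pow_of_isWeightedHomogeneous hY, Phi'Map]
  congr 2
  funext a
  rcases a with a | a | a <;> simp [wX, wY]

theorem stmt18 (K : Type) [Field K] (d μ1 μ2 : ℕ) (hμ12 : μ1 ≤ μ2)
    (hd : 2 * (μ1 + μ2) ≤ d)
    (α β : PT K) (hα0 : α ≠ 0) (hβ0 : β ≠ 0)
    (hα : α.IsHomogeneous (d - μ1)) (hβ : β.IsHomogeneous (d - μ2))
    (hcop : ∀ c : PT K, c ∣ α → c ∣ β → IsUnit c)
    (i j k s t : ℕ) (hts : t ≤ s)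
    (A' B' : PBig K μ1 μ2)
    (hA' : TriHom K μ1 μ2 A' i j (k+1))
    (hB' : TriHom K μ1 μ2 B' i (j+1) k)
    (hεA' : epsMap K μ1 μ2 A' = α * X 0 ^ t * X 1 ^ (s - t))
    (hεB' : epsMap K μ1 μ2 B' = β * X 0 ^ t * X 1 ^ (s - t)) :
    Phi'Map K μ1 μ2 (A' - B') =
      ((rename Sum.inl α : PTXY K) * X (Sum.inr 1)
        - (rename Sum.inl β : PTXY K) * X (Sum.inr 0)) *
      X (Sum.inr 0) ^ j * X (Sum.inr 1) ^ k *
      X (Sum.inl 0) ^ t * X (Sum.inl 1) ^ (s - t) := by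
  rw [map_sub, Phi'Map_eq_of_triHom hA', Phi'Map_eq_of_triHom hB', hεA', hεB']
  simp only [map_mul, map_pow, rename_X]
  ring
end
end
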